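/- Let {w^j}_{j≥0} ⊆ C be a sequence generated by pDCA: for each j, s^j is a subgradient of the largest-k norm at w^j and w^{j+1} minimizes over C the objective G_j(w) = f_cvx(w) + (τ_dc/2) wᵀw + ρ‖w‖₁ − (τ_dc w^j − ∇f_ncvx(w^j) + ρ s^j)ᵀ w. Then every limit point w̄ of {w^j} is a stationary point of the penalized problem: there exists a subgradient s̄ of the largest-k norm at w̄ such that w̄ minimizes over C the objective G(w) = f_cvx(w) + (τ_dc/2) wᵀw + ρ‖w‖₁ − (τ_dc w̄ − ∇f_ncvx(w̄) + ρ s̄)ᵀ w. Moreover, f_p takes the common value f_p* = lim_j f_p(w^j) at every limit point of {w^j}. -/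

import Mathlib

open Matrix Finset Filter Topology

noncomputable section

/-- Kronecker product `w ⊗ w` of a vector with itself, viewed as a vector in `ℝ^{N²}`. -/
def kron2 {N : ℕ} (w : Fin N → ℝ) : Fin N × Fin N → ℝ := fun p => w p.1 * w p.2

/-- Kronecker product `w ⊗ w ⊗ w`, viewed as a vector in `ℝ^{N³}`. -/
def kron3 {N : ℕ} (w : Fin N → ℝ) : Fin N × Fin N × Fin N → ℝ :=
  fun p => w p.1 * w p.2.1 * w p.2.2

/-- Sample covariance matrix `Σ = (1/T) ∑ₜ rₜ rₜᵀ`. -/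
def covar {N T : ℕ} (r : Fin T → Fin N → ℝ) : Matrix (Fin N) (Fin N) ℝ :=
  (1 / (T : ℝ)) • ∑ t, vecMulVec (r t) (r t)

/-- Co-skewness matrix `Φ = (1/T) ∑ₜ rₜ (rₜᵀ ⊗ rₜᵀ) ∈ ℝ^{N×N²}`. -/
def coskew {N T : ℕ} (r : Fin T → Fin N → ℝ) : Matrix (Fin N) (Fin N × Fin N) ℝ :=
  (1 / (T : ℝ)) • ∑ t, vecMulVec (r t) (kron2 (r t))

/-- Co-kurtosis matrix `Ψ = (1/T) ∑ₜ rₜ (rₜᵀ ⊗ rₜᵀ ⊗ rₜᵀ) ∈ ℝ^{N×N³}`. -/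
def cokurt {N T : ℕ} (r : Fin T → Fin N → ℝ) : Matrix (Fin N) (Fin N × Fin N × Fin N) ℝ :=
  (1 / (T : ℝ)) • ∑ t, vecMulVec (r t) (kron3 (r t))

/-- Third sample central moment `φ₃(w) = (1/T) ∑ₜ (wᵀ rₜ)³`. -/
def phi3 {N T : ℕ} (r : Fin T → Fin N → ℝ) (w : Fin N → ℝ) : ℝ :=
  (1 / (T : ℝ)) * ∑ t, (w ⬝ᵥ r t) ^ 3

/-- Fourth sample central moment `φ₄(w) = (1/T) ∑ₜ (wᵀ rₜ)⁴`. -/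
def phi4 {N T : ℕ} (r : Fin T → Fin N → ℝ) (w : Fin N → ℝ) : ℝ :=
  (1 / (T : ℝ)) * ∑ t, (w ⬝ᵥ r t) ^ 4

/-- The ℓ₁ norm `‖w‖₁ = ∑ᵢ |wᵢ|`. -/
def ell1 {N : ℕ} (w : Fin N → ℝ) : ℝ := ∑ i, |w i|

/-- The largest-`k` norm `‖w‖_[k]`: the maximum of `∑_{i ∈ S} |wᵢ|` over subsets `S` of
cardinality `k` (for `k ≤ N` the set below is a nonempty finite set of reals, so its
supremum is this maximum). -/
def topk {N : ℕ} (k : ℕ) (w : Fin N → ℝ) : ℝ :=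
  sSup {x : ℝ | ∃ S : Finset (Fin N), S.card = k ∧ x = ∑ i ∈ S, |w i|}

/-- `s` is a subgradient of the largest-`k` norm at `w`. -/
def IsSubgradTopk {N : ℕ} (k : ℕ) (w s : Fin N → ℝ) : Prop :=
  ∀ v : Fin N → ℝ, topk k w + s ⬝ᵥ (v - w) ≤ topk k v

/-- Feasible set `C = {w : 1ᵀ w = 1, |wᵢ| ≤ α ∀i}`. -/
def Feas (N : ℕ) (α : ℝ) : Set (Fin N → ℝ) :=
  {w | ∑ i, w i = 1 ∧ ∀ i, |w i| ≤ α}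

/-- Maximum absolute row sum `max_{1≤i≤N} ∑ⱼ |A_{ij}|` (as the supremum of a nonempty
finite set of reals when `N ≥ 1`). -/
def maxRowSum {N : ℕ} {J : Type} [Fintype J] (A : Matrix (Fin N) J ℝ) : ℝ :=
  sSup (Set.range fun i : Fin N => ∑ j, |A i j|)

/-- The DC constant `τ_dc = 6αλ₃ max-row-sum(Φ) + 12α²λ₄ max-row-sum(Ψ)`. -/
def tauDC {N T : ℕ} (α l3 l4 : ℝ) (r : Fin T → Fin N → ℝ) : ℝ :=
  6 * α * l3 * maxRowSum (coskew r) + 12 * α ^ 2 * l4 * maxRowSum (cokurt r)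

/-- Convex part `f_cvx(w) = -λ₁ μᵀw + λ₂ wᵀ Σ w`. -/
def fcvx {N T : ℕ} (l1 l2 : ℝ) (μ : Fin N → ℝ) (r : Fin T → Fin N → ℝ) (w : Fin N → ℝ) : ℝ :=
  -l1 * (μ ⬝ᵥ w) + l2 * (w ⬝ᵥ (covar r).mulVec w)

/-- Non-convex part `f_ncvx(w) = -λ₃ wᵀ Φ (w⊗w) + λ₄ wᵀ Ψ (w⊗w⊗w)`. -/
def fncvx {N T : ℕ} (l3 l4 : ℝ) (r : Fin T → Fin N → ℝ) (w : Fin N → ℝ) : ℝ :=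
  -l3 * (w ⬝ᵥ (coskew r).mulVec (kron2 w)) + l4 * (w ⬝ᵥ (cokurt r).mulVec (kron3 w))

/-- Gradient of the non-convex part: `∇f_ncvx(w) = -3λ₃ Φ(w⊗w) + 4λ₄ Ψ(w⊗w⊗w)`. -/
def gradfncvx {N T : ℕ} (l3 l4 : ℝ) (r : Fin T → Fin N → ℝ) (w : Fin N → ℝ) : Fin N → ℝ :=
  (-(3 * l3)) • (coskew r).mulVec (kron2 w) + (4 * l4) • (cokurt r).mulVec (kron3 w)

/-- Gradient of the MVSK objective `∇f = ∇f_cvx + ∇f_ncvx`. -/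
def gradf {N T : ℕ} (l1 l2 l3 l4 : ℝ) (μ : Fin N → ℝ) (r : Fin T → Fin N → ℝ)
    (w : Fin N → ℝ) : Fin N → ℝ :=
  ((-l1) • μ + (2 * l2) • (covar r).mulVec w) + gradfncvx l3 l4 r w

/-- The MVSK objective `f = f_cvx + f_ncvx`. -/
def ftot {N T : ℕ} (l1 l2 l3 l4 : ℝ) (μ : Fin N → ℝ) (r : Fin T → Fin N → ℝ)
    (w : Fin N → ℝ) : ℝ :=
  fcvx l1 l2 μ r w + fncvx l3 l4 r w

/-- The penalized objective `f_p(w) = f(w) + ρ (‖w‖₁ - ‖w‖_[k])`. -/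
def fpen {N T : ℕ} (l1 l2 l3 l4 ρ : ℝ) (k : ℕ) (μ : Fin N → ℝ) (r : Fin T → Fin N → ℝ)
    (w : Fin N → ℝ) : ℝ :=
  ftot l1 l2 l3 l4 μ r w + ρ * (ell1 w - topk k w)

/-- The Kronecker product `I_N ⊗ w ∈ ℝ^{N²×N}` of the identity matrix with a (column) vector. -/
def kronIdVec {N : ℕ} (w : Fin N → ℝ) : Matrix (Fin N × Fin N) (Fin N) ℝ :=
  Matrix.of fun p j => (1 : Matrix (Fin N) (Fin N) ℝ) p.1 j * w p.2

/-- The Kronecker product `I_N ⊗ w ⊗ w ∈ ℝ^{N³×N}`. -/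
def kronIdVec2 {N : ℕ} (w : Fin N → ℝ) : Matrix (Fin N × Fin N × Fin N) (Fin N) ℝ :=
  Matrix.of fun p j => (1 : Matrix (Fin N) (Fin N) ℝ) p.1 j * w p.2.1 * w p.2.2

/-- The pDCA subproblem objective
`G(w) = f_cvx(w) + (τ_dc/2) wᵀw + ρ‖w‖₁ - (τ_dc wʲ - ∇f_ncvx(wʲ) + ρ sʲ)ᵀ w`. -/
def Gpdca {N T : ℕ} (l1 l2 l3 l4 α ρ : ℝ) (μ : Fin N → ℝ) (r : Fin T → Fin N → ℝ)
    (wj sj w : Fin N → ℝ) : ℝ :=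
  fcvx l1 l2 μ r w + tauDC α l3 l4 r / 2 * (w ⬝ᵥ w) + ρ * ell1 w
    - (tauDC α l3 l4 r • wj - gradfncvx l3 l4 r wj + ρ • sj) ⬝ᵥ w

end

section LargestKNorm

variable {N k : ℕ}

theorem topk_eq_sup' (hk : (powersetCard k (univ : Finset (Fin N))).Nonempty) (w : Fin N → ℝ) :
    topk k w = (powersetCard k univ).sup' hk fun S => ∑ i ∈ S, |w i| := by
  rw [Finset.sup'_eq_csSup_image, topk]
  congr 1
  ext x
  simp [mem_powersetCard, eq_comm]

theorem powersetCard_univ_fin_nonempty (hkN : k ≤ N) :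
    (powersetCard k (univ : Finset (Fin N))).Nonempty :=
  powersetCard_nonempty.2 (by simpa using hkN)

theorem continuous_topk (hkN : k ≤ N) : Continuous (topk (N := N) k) := by
  have hk := powersetCard_univ_fin_nonempty hkN
  rw [funext (topk_eq_sup' hk)]
  exact Continuous.finset_sup'_apply hk fun S _ => by fun_prop

theorem topk_add_le (hkN : k ≤ N) (w v : Fin N → ℝ) : topk k (w + v) ≤ topk k w + ell1 v := by
  have hk := powersetCard_univ_fin_nonempty hkN
  rw [topk_eq_sup' hk, topk_eq_sup' hk]
  refine Finset.sup'_le hk _ fun S hS => ?_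
  calc ∑ i ∈ S, |(w + v) i| ≤ ∑ i ∈ S, |w i| + ∑ i ∈ S, |v i| := by
        rw [← sum_add_distrib]
        exact sum_le_sum fun i _ => abs_add_le _ _
    _ ≤ _ := add_le_add (Finset.le_sup' (fun S => ∑ i ∈ S, |w i|) hS)
        (sum_le_sum_of_subset_of_nonneg (subset_univ S) fun i _ _ => abs_nonneg _)

theorem IsSubgradTopk.dotProduct_le (hkN : k ≤ N) {w s : Fin N → ℝ} (hs : IsSubgradTopk k w s)
    (v : Fin N → ℝ) : s ⬝ᵥ v ≤ ell1 v := by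
  have h := hs (w + v)
  rw [add_sub_cancel_left] at h
  linarith [topk_add_le hkN w v]

theorem ell1_single (i : Fin N) (c : ℝ) : ell1 (Pi.single i c) = |c| := by
  rw [ell1, sum_eq_single i (fun j _ hj => by simp [hj]) (by simp), Pi.single_eq_same]

theorem IsSubgradTopk.mem_Icc (hkN : k ≤ N) {w s : Fin N → ℝ} (hs : IsSubgradTopk k w s) :
    s ∈ Set.Icc (-1 : Fin N → ℝ) 1 := by
  refine ⟨fun i => ?_, fun i => ?_⟩
  · have h := hs.dotProduct_le hkN (Pi.single i (-1))
    rw [ell1_single, dotProduct_single] at h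
    norm_num at h
    simpa using by linarith
  · have h := hs.dotProduct_le hkN (Pi.single i 1)
    rw [ell1_single, dotProduct_single] at h
    simpa using h

/-- The subdifferential of the largest-`k` norm has closed graph. -/
theorem IsSubgradTopk.of_tendsto (hkN : k ≤ N) {w s : ℕ → Fin N → ℝ} {w₀ s₀ : Fin N → ℝ}
    (hs : ∀ n, IsSubgradTopk k (w n) (s n)) (hw : Tendsto w atTop (𝓝 w₀))
    (hs₀ : Tendsto s atTop (𝓝 s₀)) : IsSubgradTopk k w₀ s₀ := fun v => by
  have hc : Continuous fun p : (Fin N → ℝ) × (Fin N → ℝ) => topk k p.1 + p.2 ⬝ᵥ (v - p.1) := by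
    have := continuous_topk (N := N) hkN
    unfold dotProduct
    fun_prop
  exact le_of_tendsto ((hc.tendsto (w₀, s₀)).comp (hw.prodMk_nhds hs₀))
    (Eventually.of_forall fun n => hs n v)

end LargestKNorm

theorem isCompact_feas (N : ℕ) (α : ℝ) : IsCompact (Feas N α) := by
  have h : Feas N α = {w | ∑ i, w i = 1} ∩ Set.Icc (fun _ => -α) (fun _ => α) := by
    ext w
    simp [Feas, abs_le, Pi.le_def, forall_and]
  rw [h]
  exact isCompact_Icc.inter_left (isClosed_eq (by fun_prop) continuous_const)

section Moments

variable {N T : ℕ}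

theorem dotProduct_smul_sum_vecMulVec_mulVec {J : Type} [Fintype J] (c : ℝ)
    (r : Fin T → Fin N → ℝ) (ψ : Fin T → J → ℝ) (x : Fin N → ℝ) (y : J → ℝ) :
    x ⬝ᵥ (c • ∑ t, vecMulVec (r t) (ψ t)) *ᵥ y = c * ∑ t, (x ⬝ᵥ r t) * (ψ t ⬝ᵥ y) := by
  rw [smul_mulVec, dotProduct_smul, sum_mulVec, dotProduct_sum, smul_eq_mul]
  congr 1
  refine sum_congr rfl fun t _ => ?_
  rw [vecMulVec_mulVec]
  simp [mul_comm]

theorem dotProduct_coskew_mulVec (r : Fin T → Fin N → ℝ) (x : Fin N → ℝ) (y : Fin N × Fin N → ℝ) :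
    x ⬝ᵥ (coskew r) *ᵥ y = 1 / (T : ℝ) * ∑ t, (x ⬝ᵥ r t) * (kron2 (r t) ⬝ᵥ y) :=
  dotProduct_smul_sum_vecMulVec_mulVec _ _ _ _ _

theorem dotProduct_cokurt_mulVec (r : Fin T → Fin N → ℝ) (x : Fin N → ℝ)
    (y : Fin N × Fin N × Fin N → ℝ) :
    x ⬝ᵥ (cokurt r) *ᵥ y = 1 / (T : ℝ) * ∑ t, (x ⬝ᵥ r t) * (kron3 (r t) ⬝ᵥ y) :=
  dotProduct_smul_sum_vecMulVec_mulVec _ _ _ _ _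

theorem kron2_dotProduct_mul (r x y : Fin N → ℝ) :
    (kron2 r ⬝ᵥ fun p => x p.1 * y p.2) = (x ⬝ᵥ r) * (y ⬝ᵥ r) := by
  simp only [dotProduct, kron2, Fintype.sum_prod_type, sum_mul_sum]
  exact sum_congr rfl fun i _ => sum_congr rfl fun j _ => by ring

theorem kron3_dotProduct_mul (r x : Fin N → ℝ) (y : Fin N × Fin N → ℝ) :
    (kron3 r ⬝ᵥ fun p => x p.1 * y p.2) = (x ⬝ᵥ r) * (kron2 r ⬝ᵥ y) := by
  simp only [dotProduct, kron2, kron3, Fintype.sum_prod_type (α₁ := Fin N), sum_mul_sum]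
  simp only [mul_sum]
  exact sum_congr rfl fun i _ => sum_congr rfl fun j _ => sum_congr rfl fun l _ => by ring

theorem kron2_dotProduct_kron2 (r x : Fin N → ℝ) : kron2 r ⬝ᵥ kron2 x = (x ⬝ᵥ r) ^ 2 :=
  (kron2_dotProduct_mul r x x).trans (sq _).symm

theorem kron3_dotProduct_kron3 (r x : Fin N → ℝ) : kron3 r ⬝ᵥ kron3 x = (x ⬝ᵥ r) ^ 3 := by
  have h : kron3 x = fun p => x p.1 * kron2 x p.2 := by
    ext p
    simp [kron3, kron2, mul_assoc]
  rw [h, kron3_dotProduct_mul, kron2_dotProduct_kron2]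
  ring

/-- Second-order remainder of `f_ncvx`, written with the co-moment matrices. -/
theorem fncvx_eq_taylor (l3 l4 : ℝ) (r : Fin T → Fin N → ℝ) (w v : Fin N → ℝ) :
    fncvx l3 l4 r v = fncvx l3 l4 r w + gradfncvx l3 l4 r w ⬝ᵥ (v - w)
      + l3 * ((v - w) ⬝ᵥ (coskew r) *ᵥ fun p => (v - w) p.1 * (-((2 : ℝ) • w + v)) p.2)
      + l4 * ((v - w) ⬝ᵥ (cokurt r) *ᵥ fun p => (v - w) p.1 * ((3 : ℝ) • kron2 w
        + (2 : ℝ) • (fun q : Fin N × Fin N => w q.1 * v q.2) + kron2 v) p.2) := by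
  rw [dotProduct_comm (gradfncvx l3 l4 r w)]
  simp only [fncvx, gradfncvx, dotProduct_add (v - w), dotProduct_smul, dotProduct_coskew_mulVec,
    dotProduct_cokurt_mulVec, kron2_dotProduct_mul, kron3_dotProduct_mul, dotProduct_add,
    kron2_dotProduct_kron2, kron3_dotProduct_kron3, sub_dotProduct, neg_dotProduct, add_dotProduct,
    smul_dotProduct, smul_eq_mul]
  simp only [mul_sum, ← sum_add_distrib, ← sum_sub_distrib]
  exact sum_congr rfl fun t _ => by ring

theorem sum_abs_le_maxRowSum {J : Type} [Fintype J] (A : Matrix (Fin N) J ℝ) (i : Fin N) :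
    ∑ j, |A i j| ≤ maxRowSum A :=
  le_csSup (Set.finite_range _).bddAbove (Set.mem_range_self i)

/-- A symmetric quadratic form with coefficients `∑ₚ A_{i,(j,p)} uₚ` is bounded through the maximal
absolute row sum of `A`. -/
theorem dotProduct_mulVec_mul_le {J : Type} [Fintype J] (A : Matrix (Fin N) (Fin N × J) ℝ)
    (hA : ∀ i j p, A i (j, p) = A j (i, p)) (d : Fin N → ℝ) (u : J → ℝ) {B : ℝ} (hB : 0 ≤ B)
    (hu : ∀ p, |u p| ≤ B) :
    (d ⬝ᵥ A *ᵥ fun q => d q.1 * u q.2) ≤ B * maxRowSum A * (d ⬝ᵥ d) := by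
  have hswap : ∑ i, ∑ j, ∑ p, |A i (j, p)| * d j ^ 2 = ∑ i, ∑ j, ∑ p, |A i (j, p)| * d i ^ 2 := by
    rw [sum_comm]
    exact sum_congr rfl fun i _ => sum_congr rfl fun j _ => sum_congr rfl fun p _ => by rw [hA]
  have hterm (i j p) : d i * (A i (j, p) * (d j * u p))
      ≤ B / 2 * (|A i (j, p)| * d i ^ 2) + B / 2 * (|A i (j, p)| * d j ^ 2) := by
    calc d i * (A i (j, p) * (d j * u p)) ≤ |d i * (A i (j, p) * (d j * u p))| := le_abs_self _
      _ = |A i (j, p)| * (|d i| * |d j|) * |u p| := by simp only [abs_mul]; ring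
      _ ≤ |A i (j, p)| * (|d i| * |d j|) * B := by gcongr; exact hu p
      _ ≤ |A i (j, p)| * ((d i ^ 2 + d j ^ 2) / 2) * B := by
        gcongr
        nlinarith [sq_nonneg (|d i| - |d j|), sq_abs (d i), sq_abs (d j)]
      _ = _ := by ring
  calc (d ⬝ᵥ A *ᵥ fun q => d q.1 * u q.2)
      = ∑ i, ∑ j, ∑ p, d i * (A i (j, p) * (d j * u p)) := by
        simp only [dotProduct, mulVec, Fintype.sum_prod_type, mul_sum]
    _ ≤ ∑ i, ∑ j, ∑ p,
        (B / 2 * (|A i (j, p)| * d i ^ 2) + B / 2 * (|A i (j, p)| * d j ^ 2)) :=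
        sum_le_sum fun i _ => sum_le_sum fun j _ => sum_le_sum fun p _ => hterm i j p
    _ = B * ∑ i, (∑ q, |A i q|) * d i ^ 2 := by
        simp only [sum_add_distrib, ← mul_sum]
        rw [hswap]
        simp only [Fintype.sum_prod_type, sum_mul]
        ring
    _ ≤ B * ∑ i, maxRowSum A * d i ^ 2 := by
        gcongr with i
        exact sum_abs_le_maxRowSum A i
    _ = _ := by simp only [dotProduct, ← mul_sum, mul_assoc, sq]

theorem coskew_symm (r : Fin T → Fin N → ℝ) (i j p : Fin N) :
    coskew r i (j, p) = coskew r j (i, p) := by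
  simp only [coskew, Matrix.smul_apply, Matrix.sum_apply, vecMulVec_apply, kron2]
  congr 1
  exact sum_congr rfl fun t _ => by ring

theorem cokurt_symm (r : Fin T → Fin N → ℝ) (i j : Fin N) (p : Fin N × Fin N) :
    cokurt r i (j, p) = cokurt r j (i, p) := by
  simp only [cokurt, Matrix.smul_apply, Matrix.sum_apply, vecMulVec_apply, kron3]
  congr 1
  exact sum_congr rfl fun t _ => by ring

/-- Quadratic upper bound for `f_ncvx` on the feasible set, with constant `τ_dc`. -/
theorem fncvx_le_quadratic {l3 l4 α : ℝ} (hl3 : 0 ≤ l3) (hl4 : 0 ≤ l4) (hα : 0 ≤ α)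
    (r : Fin T → Fin N → ℝ) {w v : Fin N → ℝ} (hw : w ∈ Feas N α) (hv : v ∈ Feas N α) :
    fncvx l3 l4 r v ≤ fncvx l3 l4 r w + gradfncvx l3 l4 r w ⬝ᵥ (v - w)
      + tauDC α l3 l4 r / 2 * ((v - w) ⬝ᵥ (v - w)) := by
  have hmul {a b : ℝ} (ha : |a| ≤ α) (hb : |b| ≤ α) : |a * b| ≤ α ^ 2 := by
    rw [abs_mul, sq]
    exact mul_le_mul ha hb (abs_nonneg _) hα
  have h3 := dotProduct_mulVec_mul_le (coskew r) (coskew_symm r) (v - w) (-((2 : ℝ) • w + v))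
    (B := 3 * α) (by positivity) fun p => by
      have h₁ := abs_le.1 (hw.2 p)
      have h₂ := abs_le.1 (hv.2 p)
      simp only [Pi.neg_apply, Pi.add_apply, Pi.smul_apply, smul_eq_mul, abs_le]
      constructor <;> linarith
  have h4 := dotProduct_mulVec_mul_le (cokurt r) (cokurt_symm r) (v - w)
    ((3 : ℝ) • kron2 w + (2 : ℝ) • (fun q : Fin N × Fin N => w q.1 * v q.2) + kron2 v)
    (B := 6 * α ^ 2) (by positivity) fun p => by
      have h₁ := abs_le.1 (hmul (hw.2 p.1) (hw.2 p.2))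
      have h₂ := abs_le.1 (hmul (hw.2 p.1) (hv.2 p.2))
      have h₃ := abs_le.1 (hmul (hv.2 p.1) (hv.2 p.2))
      simp only [kron2, Pi.add_apply, Pi.smul_apply, smul_eq_mul, abs_le]
      constructor <;> linarith
  rw [fncvx_eq_taylor l3 l4 r w v, tauDC]
  linarith [mul_le_mul_of_nonneg_left h3 hl3, mul_le_mul_of_nonneg_left h4 hl4]

end Moments

section Majorizer

variable {N T : ℕ}

/-- The constant by which the majorizer of `f_p` at `x` exceeds the subproblem objective. -/
noncomputable def majorizerShift (l3 l4 α ρ : ℝ) (k : ℕ) (r : Fin T → Fin N → ℝ) (x s : Fin N → ℝ) : ℝ :=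
  fncvx l3 l4 r x - gradfncvx l3 l4 r x ⬝ᵥ x + tauDC α l3 l4 r / 2 * (x ⬝ᵥ x)
    - ρ * topk k x + ρ * (s ⬝ᵥ x)

/-- The convex majorizer of `f_p` minimized by one step of pDCA from `x` with subgradient `s`. -/
noncomputable def majorizer (l1 l2 l3 l4 α ρ : ℝ) (k : ℕ) (μ : Fin N → ℝ) (r : Fin T → Fin N → ℝ)
    (x s v : Fin N → ℝ) : ℝ :=
  Gpdca l1 l2 l3 l4 α ρ μ r x s v + majorizerShift l3 l4 α ρ k r x s

theorem majorizer_self (l1 l2 l3 l4 α ρ : ℝ) (k : ℕ) (μ : Fin N → ℝ) (r : Fin T → Fin N → ℝ)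
    (x s : Fin N → ℝ) :
    majorizer l1 l2 l3 l4 α ρ k μ r x s x = fpen l1 l2 l3 l4 ρ k μ r x := by
  simp only [majorizer, majorizerShift, Gpdca, fpen, ftot, add_dotProduct, sub_dotProduct,
    smul_dotProduct, smul_eq_mul]
  ring

theorem majorizer_le_majorizer_iff {l1 l2 l3 l4 α ρ : ℝ} {k : ℕ} {μ : Fin N → ℝ}
    {r : Fin T → Fin N → ℝ} {x s u v : Fin N → ℝ} :
    majorizer l1 l2 l3 l4 α ρ k μ r x s u ≤ majorizer l1 l2 l3 l4 α ρ k μ r x s v ↔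
      Gpdca l1 l2 l3 l4 α ρ μ r x s u ≤ Gpdca l1 l2 l3 l4 α ρ μ r x s v :=
  add_le_add_iff_right _

theorem fpen_le_majorizer (l1 l2 : ℝ) {l3 l4 α ρ : ℝ} (hl3 : 0 ≤ l3) (hl4 : 0 ≤ l4) (hα : 0 ≤ α)
    (hρ : 0 ≤ ρ) {k : ℕ} (μ : Fin N → ℝ) (r : Fin T → Fin N → ℝ) {x s v : Fin N → ℝ}
    (hx : x ∈ Feas N α) (hv : v ∈ Feas N α) (hs : IsSubgradTopk k x s) :
    fpen l1 l2 l3 l4 ρ k μ r v ≤ majorizer l1 l2 l3 l4 α ρ k μ r x s v := by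
  have h₁ := fncvx_le_quadratic hl3 hl4 hα r hx hv
  have h₂ := mul_le_mul_of_nonneg_left (hs v) hρ
  simp only [dotProduct_sub, sub_dotProduct, dotProduct_comm v x] at h₁ h₂
  simp only [majorizer, majorizerShift, Gpdca, fpen, ftot, add_dotProduct, sub_dotProduct,
    smul_dotProduct, smul_eq_mul]
  linarith

theorem continuous_fcvx (l1 l2 : ℝ) (μ : Fin N → ℝ) (r : Fin T → Fin N → ℝ) :
    Continuous (fcvx l1 l2 μ r) := by
  unfold fcvx dotProduct mulVec dotProduct
  fun_prop

theorem continuous_fncvx (l3 l4 : ℝ) (r : Fin T → Fin N → ℝ) : Continuous (fncvx l3 l4 r) := by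
  unfold fncvx dotProduct mulVec dotProduct kron2 kron3
  fun_prop

theorem continuous_gradfncvx (l3 l4 : ℝ) (r : Fin T → Fin N → ℝ) :
    Continuous (gradfncvx l3 l4 r) := by
  refine continuous_pi fun i => ?_
  simp only [gradfncvx, Pi.add_apply, Pi.smul_apply, mulVec, dotProduct, kron2, kron3]
  fun_prop

theorem continuous_fpen (l1 l2 l3 l4 ρ : ℝ) {k : ℕ} (hkN : k ≤ N) (μ : Fin N → ℝ)
    (r : Fin T → Fin N → ℝ) : Continuous (fpen l1 l2 l3 l4 ρ k μ r) := by
  have := continuous_topk hkN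
  have := continuous_fcvx l1 l2 μ r
  have := continuous_fncvx l3 l4 r
  unfold fpen ftot ell1
  fun_prop

theorem continuous_majorizer (l1 l2 l3 l4 α ρ : ℝ) {k : ℕ} (hkN : k ≤ N) (μ : Fin N → ℝ)
    (r : Fin T → Fin N → ℝ) (v : Fin N → ℝ) :
    Continuous fun p : (Fin N → ℝ) × (Fin N → ℝ) =>
      majorizer l1 l2 l3 l4 α ρ k μ r p.1 p.2 v := by
  have := continuous_topk hkN
  have := continuous_fncvx l3 l4 r
  have := continuous_gradfncvx l3 l4 r
  unfold majorizer majorizerShift Gpdca dotProduct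
  simp only [Pi.add_apply, Pi.sub_apply, Pi.smul_apply]
  fun_prop

theorem tendsto_majorizer (l1 l2 l3 l4 α ρ : ℝ) {k : ℕ} (hkN : k ≤ N) (μ : Fin N → ℝ)
    (r : Fin T → Fin N → ℝ) (v : Fin N → ℝ) {x s : ℕ → Fin N → ℝ} {x₀ s₀ : Fin N → ℝ}
    (hx : Tendsto x atTop (𝓝 x₀)) (hs : Tendsto s atTop (𝓝 s₀)) :
    Tendsto (fun n => majorizer l1 l2 l3 l4 α ρ k μ r (x n) (s n) v) atTop
      (𝓝 (majorizer l1 l2 l3 l4 α ρ k μ r x₀ s₀ v)) := by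
  have hc := (continuous_majorizer l1 l2 l3 l4 α ρ hkN μ r v).tendsto (x₀, s₀)
  simpa only [Function.comp_def] using hc.comp (hx.prodMk_nhds hs)

end Majorizer

/-- for a sequence generated by pDCA, every limit point `w̄` is a stationary
point of the penalized problem (there is a subgradient `s̄` of the largest-`k` norm at `w̄`
such that `w̄` minimizes the corresponding subproblem objective over `C`), and `f_p` equals
the limit value `f_p* = lim_j f_p(wʲ)` at every limit point. -/
theorem pdca_limit_points_stationary {N T : ℕ} (hN : 0 < N) (hT : 1 ≤ T)
    (l1 l2 l3 l4 α ρ : ℝ) (hl1 : 0 < l1) (hl2 : 0 < l2) (hl3 : 0 < l3) (hl4 : 0 < l4)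
    (hα : 0 < α) (hρ : 0 < ρ) (k : ℕ) (hk1 : 1 ≤ k) (hkN : k ≤ N)
    (μ : Fin N → ℝ) (r : Fin T → Fin N → ℝ)
    (w s : ℕ → Fin N → ℝ)
    (hw : ∀ j, w j ∈ Feas N α)
    (hs : ∀ j, IsSubgradTopk k (w j) (s j))
    (hmin : ∀ j, ∀ v ∈ Feas N α,
      Gpdca l1 l2 l3 l4 α ρ μ r (w j) (s j) (w (j + 1))
        ≤ Gpdca l1 l2 l3 l4 α ρ μ r (w j) (s j) v) :
    ∃ L : ℝ, Tendsto (fun j => fpen l1 l2 l3 l4 ρ k μ r (w j)) atTop (𝓝 L) ∧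
      ∀ wbar : Fin N → ℝ,
        (∃ φ : ℕ → ℕ, StrictMono φ ∧ Tendsto (fun n => w (φ n)) atTop (𝓝 wbar)) →
          (∃ sbar : Fin N → ℝ, IsSubgradTopk k wbar sbar ∧ wbar ∈ Feas N α ∧
            ∀ v ∈ Feas N α,
              Gpdca l1 l2 l3 l4 α ρ μ r wbar sbar wbar
                ≤ Gpdca l1 l2 l3 l4 α ρ μ r wbar sbar v) ∧
          fpen l1 l2 l3 l4 ρ k μ r wbar = L := by
  have hstep (j : ℕ) : majorizer l1 l2 l3 l4 α ρ k μ r (w j) (s j) (w (j + 1))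
      ≤ fpen l1 l2 l3 l4 ρ k μ r (w j) := by
    rw [← majorizer_self l1 l2 l3 l4 α ρ k μ r (w j) (s j)]
    exact majorizer_le_majorizer_iff.2 (hmin j _ (hw j))
  have hmaj (j : ℕ) : fpen l1 l2 l3 l4 ρ k μ r (w (j + 1))
      ≤ majorizer l1 l2 l3 l4 α ρ k μ r (w j) (s j) (w (j + 1)) :=
    fpen_le_majorizer l1 l2 hl3.le hl4.le hα.le hρ.le μ r (hw j) (hw (j + 1)) (hs j)
  have hcont := continuous_fpen l1 l2 l3 l4 ρ hkN μ r
  have hanti : Antitone fun j => fpen l1 l2 l3 l4 ρ k μ r (w j) :=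
    antitone_nat_of_succ_le fun j => (hmaj j).trans (hstep j)
  have hbdd : BddBelow (Set.range fun j => fpen l1 l2 l3 l4 ρ k μ r (w j)) :=
    ((isCompact_feas N α).bddBelow_image hcont.continuousOn).mono <| by
      rintro _ ⟨j, rfl⟩
      exact ⟨w j, hw j, rfl⟩
  obtain ⟨L, hL⟩ : ∃ L, Tendsto (fun j => fpen l1 l2 l3 l4 ρ k μ r (w j)) atTop (𝓝 L) :=
    ⟨_, tendsto_atTop_ciInf hanti hbdd⟩
  refine ⟨L, hL, ?_⟩
  rintro wbar ⟨φ, hφ, hlim⟩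
  have hval : fpen l1 l2 l3 l4 ρ k μ r wbar = L :=
    tendsto_nhds_unique ((hcont.tendsto wbar).comp hlim) (hL.comp hφ.tendsto_atTop)
  obtain ⟨sbar, -, ψ, hψ, hslim⟩ :=
    isCompact_Icc.tendsto_subseq fun n => (hs (φ n)).mem_Icc hkN
  have hwlim := hlim.comp hψ.tendsto_atTop
  have hsub : IsSubgradTopk k wbar sbar :=
    IsSubgradTopk.of_tendsto hkN (fun n => hs (φ (ψ n))) hwlim hslim
  refine ⟨⟨sbar, hsub, (isCompact_feas N α).isClosed.mem_of_tendsto hlim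
    (Eventually.of_forall fun n => hw _), fun v hv => ?_⟩, hval⟩
  have hlower : Tendsto (fun n => fpen l1 l2 l3 l4 ρ k μ r (w (φ (ψ n) + 1))) atTop (𝓝 L) :=
    hL.comp ((tendsto_add_atTop_nat 1).comp (hφ.comp hψ).tendsto_atTop)
  have hupper : Tendsto (fun n => majorizer l1 l2 l3 l4 α ρ k μ r (w (φ (ψ n))) (s (φ (ψ n))) v)
      atTop (𝓝 (majorizer l1 l2 l3 l4 α ρ k μ r wbar sbar v)) :=
    tendsto_majorizer l1 l2 l3 l4 α ρ hkN μ r v hwlim hslim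
  have hle := le_of_tendsto_of_tendsto' hlower hupper fun n =>
    (hmaj (φ (ψ n))).trans (majorizer_le_majorizer_iff.2 (hmin (φ (ψ n)) v hv))
  rw [← hval, ← majorizer_self l1 l2 l3 l4 α ρ k μ r wbar sbar] at hle
  exact majorizer_le_majorizer_iff.1 hle
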